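/- Let ρ₀ ∈ L^∞(ℝ^d) with ρ₀ ≥ 0. Then the kinetic equation d/dt ρ_t(x) = −ρ_t(x) h(ρ_t, x) + R₂(ρ_t, x), with initial condition ρ_{t=0} = ρ₀, has a unique local classical solution: there exists T* > 0 and a unique continuously differentiable map ρ : [0, T*] → L^∞(ℝ^d) with ρ_t ≥ 0 for all t, satisfying the equation on [0, T*] and ρ_0 = ρ₀. -/

import Mathlib

open MeasureTheory Set

noncomputable section

/-- Euclidean space `ℝ^d`, modeled as functions `Fin d → ℝ`. -/
abbrev Rd (d : ℕ) := Fin d → ℝ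

/-- The (sup) `L^∞` norm of a function on `ℝ^d`. -/
def linf {d : ℕ} (f : Rd d → ℝ) : ℝ := ⨆ x, |f x|

/-- Membership in `L^∞(ℝ^d)`: measurable and (everywhere) bounded. -/
def MemLinf {d : ℕ} (f : Rd d → ℝ) : Prop := Measurable f ∧ ∃ M : ℝ, ∀ x, |f x| ≤ M

/-- `h(ρ,x) = (1/2) ∬ (c₁(x,y;z)+c₁(y,x;z)) ρ(y) dy dz + ⟨c₂⟩`. -/
def hker {d : ℕ} (c₁ : Rd d → Rd d → Rd d → ℝ) (C2 : ℝ) (ρ : Rd d → ℝ) (x : Rd d) : ℝ :=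
  1/2 * (∫ y, ∫ z, (c₁ x y z + c₁ y x z) * ρ y) + C2

/-- `R₂(ρ,x)`, the positive part of the right-hand side of the kinetic equation. -/
def R2 {d : ℕ} (c₁ : Rd d → Rd d → Rd d → ℝ) (c₂ : Rd d → Rd d → ℝ)
    (φ₁ φ₂ : Rd d → ℝ) (ρ : Rd d → ℝ) (x : Rd d) : ℝ :=
  1/2 * (∫ y, ∫ z, c₁ y z x * Real.exp (-∫ u, φ₁ (x - u) * ρ u) * ρ y * ρ z)
    + 1/2 * (∫ y, ∫ z, (c₁ x y z + c₁ y x z) *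
        (1 - Real.exp (-∫ u, φ₁ (z - u) * ρ u)) * ρ x * ρ y)
    + (∫ y, c₂ y x * Real.exp (-∫ u, φ₂ (x - u) * ρ u) * ρ y)
    + (∫ y, c₂ x y * (1 - Real.exp (-∫ u, φ₂ (y - u) * ρ u)) * ρ x)

/-- The fixed point map `F` given by the right-hand side of the integral equation. -/
def Fmap {d : ℕ} (c₁ : Rd d → Rd d → Rd d → ℝ) (c₂ : Rd d → Rd d → ℝ)
    (φ₁ φ₂ : Rd d → ℝ) (C2 : ℝ) (ρ₀ : Rd d → ℝ) (ρ : ℝ → Rd d → ℝ) (t : ℝ) (x : Rd d) : ℝ :=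
  ρ₀ x * Real.exp (-∫ s in (0:ℝ)..t, hker c₁ C2 (ρ s) x)
    + ∫ s in (0:ℝ)..t, R2 c₁ c₂ φ₁ φ₂ (ρ s) x * Real.exp (-∫ σ in s..t, hker c₁ C2 (ρ σ) x)

/-- The weighted norm `‖ρ‖_{T,γ} = sup_{t∈[0,T]} e^{-γ⟨c₂⟩t} ‖ρ_t‖_{L^∞}`. -/
def normTg {d : ℕ} (T γ C2 : ℝ) (ρ : ℝ → Rd d → ℝ) : ℝ :=
  ⨆ t : Icc (0:ℝ) T, Real.exp (-(γ * C2 * t.1)) * linf (ρ t.1)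

/-- Continuity on `S ⊆ ℝ` of a curve of functions, in the `L^∞` norm. -/
def LinfContOn {d : ℕ} (S : Set ℝ) (ρ : ℝ → Rd d → ℝ) : Prop :=
  ∀ t ∈ S, ∀ ε > 0, ∃ δ > 0, ∀ s ∈ S, |s - t| < δ → linf (fun x => ρ s x - ρ t x) < ε

/-- Membership in the ball `B_{T,γ}(r) ⊆ C([0,T] → L^∞)`. -/
def memB {d : ℕ} (T γ C2 r : ℝ) (ρ : ℝ → Rd d → ℝ) : Prop :=
  LinfContOn (Icc 0 T) ρ ∧ (∀ t ∈ Icc (0:ℝ) T, MemLinf (ρ t)) ∧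
    (∀ t ∈ Icc (0:ℝ) T, ∀ x, 0 ≤ ρ t x) ∧ normTg T γ C2 ρ ≤ r

/-- Differentiability at `t` (within `S ⊆ ℝ`) of a curve, in the `L^∞` norm,
with derivative `g`. -/
def HasLinfDerivWithinAt {d : ℕ} (ρ : ℝ → Rd d → ℝ) (g : Rd d → ℝ) (S : Set ℝ) (t : ℝ) : Prop :=
  ∀ ε > 0, ∃ δ > 0, ∀ s ∈ S, |s - t| < δ →
    linf (fun x => ρ s x - ρ t x - (s - t) * g x) ≤ ε * |s - t|

/-- The right-hand side of the kinetic equation: `−ρ(x) h(ρ,x) + R₂(ρ,x)`. -/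
def kderiv {d : ℕ} (c₁ : Rd d → Rd d → Rd d → ℝ) (c₂ : Rd d → Rd d → ℝ)
    (φ₁ φ₂ : Rd d → ℝ) (C2 : ℝ) (ρ : Rd d → ℝ) : Rd d → ℝ :=
  fun x => -(ρ x) * hker c₁ C2 ρ x + R2 c₁ c₂ φ₁ φ₂ ρ x

/-- `ρ` is a (local) classical solution of the kinetic equation on `[0,T]` with initial
value `ρ₀`: nonnegative and `L^∞`-valued, continuously differentiable in the `L^∞` norm,
and satisfying `d/dt ρ_t = −ρ_t·h(ρ_t,·) + R₂(ρ_t,·)`, `ρ_0 = ρ₀`. -/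
def IsSol {d : ℕ} (c₁ : Rd d → Rd d → Rd d → ℝ) (c₂ : Rd d → Rd d → ℝ)
    (φ₁ φ₂ : Rd d → ℝ) (C2 : ℝ) (ρ₀ : Rd d → ℝ) (T : ℝ) (ρ : ℝ → Rd d → ℝ) : Prop :=
  (∀ t ∈ Icc (0:ℝ) T, MemLinf (ρ t)) ∧ (∀ t ∈ Icc (0:ℝ) T, ∀ x, 0 ≤ ρ t x) ∧
    ρ 0 = ρ₀ ∧
    (∀ t ∈ Icc (0:ℝ) T, HasLinfDerivWithinAt ρ (kderiv c₁ c₂ φ₁ φ₂ C2 (ρ t)) (Icc 0 T) t) ∧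
    LinfContOn (Icc 0 T) (fun t => kderiv c₁ c₂ φ₁ φ₂ C2 (ρ t))


lemma meas_int {α : Type*} [MeasurableSpace α] {d : ℕ} (f : α → Rd d → ℝ)
    (hf : Measurable fun p : α × Rd d => f p.1 p.2) : Measurable fun x => ∫ y, f x y :=
  (hf.stronglyMeasurable.integral_prod_right').measurable

lemma ker1 {α : Type*} [MeasurableSpace α] {μ : Measure α} (k f g : α → ℝ) (C K δ : ℝ)
    (hk : Integrable k μ) (hk0 : ∀ a, 0 ≤ k a) (hC : ∫ a, k a ∂μ = C)
    (hf : Measurable f) (hg : Measurable g) (hfK : ∀ a, |f a| ≤ K) (hgK : ∀ a, |g a| ≤ K)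
    (hd : ∀ a, |f a - g a| ≤ δ) :
    |∫ a, k a * f a ∂μ - ∫ a, k a * g a ∂μ| ≤ C * δ := by
  have h1 : Integrable (fun a => k a * f a) μ :=
    hk.mul_bdd (c := K) hf.aestronglyMeasurable (Filter.Eventually.of_forall hfK)
  have h2 : Integrable (fun a => k a * g a) μ :=
    hk.mul_bdd (c := K) hg.aestronglyMeasurable (Filter.Eventually.of_forall hgK)
  rw [← integral_sub h1 h2, ← hC, ← integral_mul_const]
  refine (norm_integral_le_of_norm_le (G := ℝ) (hk.mul_const δ) (Filter.Eventually.of_forall fun a => ?_))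
  rw [← mul_sub, Real.norm_eq_abs, abs_mul, abs_of_nonneg (hk0 a)]
  exact mul_le_mul_of_nonneg_left (hd a) (hk0 a)

lemma ker2 {d : ℕ} (k f g : Rd d → Rd d → ℝ) (C K δ : ℝ)
    (hk : Integrable fun p : Rd d × Rd d => k p.1 p.2) (hk0 : ∀ y z, 0 ≤ k y z)
    (hC : ∫ y, ∫ z, k y z = C)
    (hf : Measurable fun p : Rd d × Rd d => f p.1 p.2)
    (hg : Measurable fun p : Rd d × Rd d => g p.1 p.2)
    (hfK : ∀ y z, |f y z| ≤ K) (hgK : ∀ y z, |g y z| ≤ K)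
    (hd : ∀ y z, |f y z - g y z| ≤ δ) :
    |(∫ y, ∫ z, k y z * f y z) - ∫ y, ∫ z, k y z * g y z| ≤ C * δ := by
  have h1 : Integrable (fun p : Rd d × Rd d => k p.1 p.2 * f p.1 p.2) :=
    hk.mul_bdd (c := K) hf.aestronglyMeasurable (Filter.Eventually.of_forall fun p => hfK _ _)
  have h2 : Integrable (fun p : Rd d × Rd d => k p.1 p.2 * g p.1 p.2) :=
    hk.mul_bdd (c := K) hg.aestronglyMeasurable (Filter.Eventually.of_forall fun p => hgK _ _)
  have e1 := integral_prod (μ := volume) (ν := volume) _ h1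
  have e2 := integral_prod (μ := volume) (ν := volume) _ h2
  have e3 := integral_prod (μ := volume) (ν := volume) _ hk
  simp only at e1 e2 e3
  rw [← e1, ← e2]
  exact ker1 _ _ _ C K δ hk (fun p => hk0 _ _) (e3.trans hC) hf hg (fun p => hfK _ _)
    (fun p => hgK _ _) (fun p => hd _ _)

lemma conv_lip {d : ℕ} (φ : Rd d → ℝ) (Φ : ℝ) (hφnn : ∀ u, 0 ≤ φ u)
    (hφint : Integrable φ) (hφval : (∫ u, φ u) = Φ) (ρ ψ : Rd d → ℝ) (M δ : ℝ)
    (hρ : Measurable ρ) (hψ : Measurable ψ) (hρ0 : ∀ x, 0 ≤ ρ x) (hψ0 : ∀ x, 0 ≤ ψ x)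
    (hρM : ∀ x, ρ x ≤ M) (hψM : ∀ x, ψ x ≤ M) (hd : ∀ x, |ρ x - ψ x| ≤ δ) (x : Rd d) :
    |Real.exp (-∫ u, φ (x - u) * ρ u) - Real.exp (-∫ u, φ (x - u) * ψ u)| ≤ Φ * δ := by
  have h := ker1 (μ := volume) (fun u => φ (x - u)) ρ ψ Φ M δ (hφint.comp_sub_left x)
    (fun u => hφnn _) (by rw [← hφval]; exact integral_sub_left_eq_self φ volume x) hρ hψ
    (fun a => by rw [abs_of_nonneg (hρ0 a)]; exact hρM a)
    (fun a => by rw [abs_of_nonneg (hψ0 a)]; exact hψM a) hd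
  have ha : 0 ≤ ∫ u, φ (x - u) * ρ u := integral_nonneg fun u => mul_nonneg (hφnn _) (hρ0 _)
  have hb : 0 ≤ ∫ u, φ (x - u) * ψ u := integral_nonneg fun u => mul_nonneg (hφnn _) (hψ0 _)
  refine le_trans ?_ h
  generalize (∫ u, φ (x - u) * ρ u) = a at *
  generalize (∫ u, φ (x - u) * ψ u) = b at *
  have key : ∀ a b : ℝ, 0 ≤ a → a ≤ b → Real.exp (-a) - Real.exp (-b) ≤ b - a := by
    intro a b ha hab
    have h1 := Real.add_one_le_exp (-(b - a))
    have h2 : Real.exp (-b) = Real.exp (-a) * Real.exp (-(b - a)) := by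
      rw [← Real.exp_add]; congr 1; ring
    have h3 : Real.exp (-a) ≤ 1 := Real.exp_le_one_iff.2 (by linarith)
    have h4 := Real.exp_pos (-a)
    rw [h2]; nlinarith
  rcases le_total a b with hab | hab
  · have := Real.exp_le_exp.2 (neg_le_neg hab)
    rw [abs_of_nonneg (by linarith), abs_of_nonpos (by linarith)]
    linarith [key a b ha hab]
  · have := Real.exp_le_exp.2 (neg_le_neg hab)
    rw [abs_of_nonpos (by linarith), abs_of_nonneg (by linarith)]
    linarith [key b a hb hab]

lemma exp_mem {d : ℕ} (φ : Rd d → ℝ) (hφnn : ∀ u, 0 ≤ φ u) (ρ : Rd d → ℝ)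
    (hρ0 : ∀ x, 0 ≤ ρ x) (x : Rd d) :
    0 < Real.exp (-∫ u, φ (x - u) * ρ u) ∧ Real.exp (-∫ u, φ (x - u) * ρ u) ≤ 1 := by
  have ha : 0 ≤ ∫ u, φ (x - u) * ρ u := integral_nonneg fun u => mul_nonneg (hφnn _) (hρ0 _)
  exact ⟨Real.exp_pos _, Real.exp_le_one_iff.2 (by linarith)⟩

lemma exp_meas {d : ℕ} (φ : Rd d → ℝ) (hφ : Measurable φ) (ρ : Rd d → ℝ) (hρ : Measurable ρ) :
    Measurable fun x => Real.exp (-∫ u, φ (x - u) * ρ u) := by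
  have := meas_int (fun x u : Rd d => φ (x - u) * ρ u) (by fun_prop)
  fun_prop

/-- product difference estimates -/
lemma prod2 (e e' a a' A M δ : ℝ) (he : 0 ≤ e ∧ e ≤ 1) (ha' : 0 ≤ a' ∧ a' ≤ M)
    (h1 : |e - e'| ≤ A) (h2 : |a - a'| ≤ δ) : |e * a - e' * a'| ≤ A * M + δ := by
  have : e * a - e' * a' = e * (a - a') + (e - e') * a' := by ring
  rw [this]
  refine (abs_add_le _ _).trans ?_
  rw [abs_mul, abs_mul, abs_of_nonneg he.1, abs_of_nonneg ha'.1]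
  have p1 : e * |a - a'| ≤ 1 * δ := mul_le_mul he.2 h2 (abs_nonneg _) zero_le_one
  have p2 : |e - e'| * a' ≤ A * M := mul_le_mul h1 ha'.2 ha'.1 ((abs_nonneg _).trans h1)
  linarith

lemma prod3 (e e' a a' b b' A M δ : ℝ) (he : 0 ≤ e ∧ e ≤ 1) (ha : 0 ≤ a ∧ a ≤ M)
    (ha' : 0 ≤ a' ∧ a' ≤ M)
    (hb' : 0 ≤ b' ∧ b' ≤ M)
    (h1 : |e - e'| ≤ A) (h2 : |a - a'| ≤ δ) (h3 : |b - b'| ≤ δ) :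
    |e * a * b - e' * a' * b'| ≤ (A * M + 2 * δ) * M := by
  have : e * a * b - e' * a' * b' = (e * a) * (b - b') + (e * a - e' * a') * b' := by ring
  rw [this]
  refine (abs_add_le _ _).trans ?_
  have q := prod2 e e' a a' A M δ he ha' h1 h2
  have hea : 0 ≤ e * a := mul_nonneg he.1 ha.1
  have hea' : e * a ≤ M := by nlinarith [he.1, he.2, ha.1, ha.2]
  rw [abs_mul (e * a), abs_mul _ b', abs_of_nonneg hea, abs_of_nonneg hb'.1]
  have p1 : e * a * |b - b'| ≤ M * δ := mul_le_mul hea' h3 (abs_nonneg _) (hea.trans hea')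
  have p2 : |e * a - e' * a'| * b' ≤ (A * M + δ) * M :=
    mul_le_mul q hb'.2 hb'.1 ((abs_nonneg _).trans q)
  linarith

lemma pb2 (e a M : ℝ) (he : 0 ≤ e ∧ e ≤ 1) (ha : 0 ≤ a ∧ a ≤ M) : |e * a| ≤ M := by
  rw [abs_of_nonneg (mul_nonneg he.1 ha.1)]; nlinarith [he.1, he.2, ha.1, ha.2]

lemma pb3 (e a b M : ℝ) (he : 0 ≤ e ∧ e ≤ 1) (ha : 0 ≤ a ∧ a ≤ M) (hb : 0 ≤ b ∧ b ≤ M) :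
    |e * a * b| ≤ M * M := by
  have := pb2 e a M he ha
  rw [abs_mul, abs_of_nonneg hb.1]
  exact mul_le_mul this hb.2 hb.1 (ha.1.trans ha.2)

lemma kderiv_lip {d : ℕ}
    (c₁ : Rd d → Rd d → Rd d → ℝ) (C1 : ℝ)
    (hc₁nn : ∀ x y z, 0 ≤ c₁ x y z)
    (hc₁sym : ∀ x y z, c₁ x y z = c₁ y x z)
    (hc₁int₁₂ : ∀ z, Integrable fun p : Rd d × Rd d => c₁ p.1 p.2 z)
    (hc₁int₂₃ : ∀ x, Integrable fun p : Rd d × Rd d => c₁ x p.1 p.2)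
    (hc₁val₁₂ : ∀ z, (∫ x, ∫ y, c₁ x y z) = C1)
    (hc₁val₂₃ : ∀ x, (∫ y, ∫ z, c₁ x y z) = C1)
    (c₂ : Rd d → Rd d → ℝ) (C2 : ℝ)
    (hc₂nn : ∀ x y, 0 ≤ c₂ x y)
    (hc₂int₁ : ∀ y, Integrable fun x => c₂ x y)
    (hc₂int₂ : ∀ x, Integrable fun y => c₂ x y)
    (hc₂val₁ : ∀ y, (∫ x, c₂ x y) = C2)
    (hc₂val₂ : ∀ x, (∫ y, c₂ x y) = C2)
    (φ₁ : Rd d → ℝ) (Φ₁ : ℝ) (hφ₁meas : Measurable φ₁) (hφ₁nn : ∀ u, 0 ≤ φ₁ u)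
    (hφ₁int : Integrable φ₁) (hφ₁val : (∫ u, φ₁ u) = Φ₁)
    (φ₂ : Rd d → ℝ) (Φ₂ : ℝ) (hφ₂meas : Measurable φ₂) (hφ₂nn : ∀ u, 0 ≤ φ₂ u)
    (hφ₂int : Integrable φ₂) (hφ₂val : (∫ u, φ₂ u) = Φ₂) (M : ℝ) (hM : 0 ≤ M) :
    ∃ L : ℝ, 0 ≤ L ∧ ∀ (ρ ψ : Rd d → ℝ) (δ : ℝ), Measurable ρ → Measurable ψ →
      (∀ x, 0 ≤ ρ x ∧ ρ x ≤ M) → (∀ x, 0 ≤ ψ x ∧ ψ x ≤ M) → (∀ x, |ρ x - ψ x| ≤ δ) →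
      ∀ x, |kderiv c₁ c₂ φ₁ φ₂ C2 ρ x - kderiv c₁ c₂ φ₁ φ₂ C2 ψ x| ≤ L * δ := by
  have hC1 : 0 ≤ C1 := by
    rw [← hc₁val₁₂ 0]; exact integral_nonneg fun x => integral_nonneg fun y => hc₁nn _ _ _
  have hC2 : 0 ≤ C2 := by rw [← hc₂val₁ 0]; exact integral_nonneg fun x => hc₂nn _ _
  have hΦ₁ : 0 ≤ Φ₁ := by rw [← hφ₁val]; exact integral_nonneg hφ₁nn
  have hΦ₂ : 0 ≤ Φ₂ := by rw [← hφ₂val]; exact integral_nonneg hφ₂nn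
  refine ⟨(2 * M * C1 + C2) + 1/2 * (C1 * ((Φ₁ * M + 2) * M))
      + 1/2 * (2 * C1 * ((Φ₁ * M + 2) * M)) + C2 * (Φ₂ * M + 1) + C2 * (Φ₂ * M + 1),
      by positivity, ?_⟩
  intro ρ ψ δ hρ hψ hρb hψb hd x
  have hδ : 0 ≤ δ := (abs_nonneg _).trans (hd x)
  have E1 := conv_lip φ₁ Φ₁ hφ₁nn hφ₁int hφ₁val ρ ψ M δ hρ hψ (fun x => (hρb x).1)
    (fun x => (hψb x).1) (fun x => (hρb x).2) (fun x => (hψb x).2) hd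
  have E2 := conv_lip φ₂ Φ₂ hφ₂nn hφ₂int hφ₂val ρ ψ M δ hρ hψ (fun x => (hρb x).1)
    (fun x => (hψb x).1) (fun x => (hρb x).2) (fun x => (hψb x).2) hd
  have b1ρ := exp_mem φ₁ hφ₁nn ρ (fun x => (hρb x).1)
  have b1ψ := exp_mem φ₁ hφ₁nn ψ (fun x => (hψb x).1)
  have b2ρ := exp_mem φ₂ hφ₂nn ρ (fun x => (hρb x).1)
  have b2ψ := exp_mem φ₂ hφ₂nn ψ (fun x => (hψb x).1)
  have m1ρ := exp_meas φ₁ hφ₁meas ρ hρ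
  have m1ψ := exp_meas φ₁ hφ₁meas ψ hψ
  have m2ρ := exp_meas φ₂ hφ₂meas ρ hρ
  have m2ψ := exp_meas φ₂ hφ₂meas ψ hψ
  unfold kderiv hker R2
  generalize hg1 : (fun x => Real.exp (-∫ u, φ₁ (x - u) * ρ u)) = e1ρ at *
  generalize hg2 : (fun x => Real.exp (-∫ u, φ₁ (x - u) * ψ u)) = e1ψ at *
  generalize hg3 : (fun x => Real.exp (-∫ u, φ₂ (x - u) * ρ u)) = e2ρ at *
  generalize hg4 : (fun x => Real.exp (-∫ u, φ₂ (x - u) * ψ u)) = e2ψ at *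
  simp only [fun x => congrFun hg1 x, fun x => congrFun hg2 x, fun x => congrFun hg3 x,
    fun x => congrFun hg4 x] at *
  clear hg1 hg2 hg3 hg4
  have absb : ∀ a : ℝ, 0 ≤ a ∧ a ≤ M → |a| ≤ M := fun a h => by
    rw [abs_of_nonneg h.1]; exact h.2
  -- the symmetrised kernel
  have ks : Integrable fun p : Rd d × Rd d => c₁ x p.1 p.2 + c₁ p.1 x p.2 := by
    have : (fun p : Rd d × Rd d => c₁ x p.1 p.2 + c₁ p.1 x p.2)
      = fun p : Rd d × Rd d => 2 * c₁ x p.1 p.2 := by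
      funext p; rw [← hc₁sym x p.1 p.2]; ring
    rw [this]; exact (hc₁int₂₃ x).const_mul 2
  have ks0 : ∀ y z, 0 ≤ c₁ x y z + c₁ y x z := fun y z => add_nonneg (hc₁nn _ _ _) (hc₁nn _ _ _)
  have ksv : ∫ y, ∫ z, (c₁ x y z + c₁ y x z) = 2 * C1 := by
    have : (fun y z => c₁ x y z + c₁ y x z) = fun y z => 2 * c₁ x y z := by
      funext y z; rw [← hc₁sym x y z]; ring
    have h2 : ∀ y z, c₁ x y z + c₁ y x z = 2 * c₁ x y z := fun y z => congrFun (congrFun this y) z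
    simp only [h2, integral_const_mul, hc₁val₂₃ x]
  have H := ker2 (fun y z => c₁ x y z + c₁ y x z) (fun y _ => ρ y) (fun y _ => ψ y) (2 * C1) M δ
    ks ks0 ksv (by fun_prop) (by fun_prop) (fun y z => absb _ (hρb y)) (fun y z => absb _ (hψb y))
    (fun y _ => hd y)
  have H0 := ker2 (fun y z => c₁ x y z + c₁ y x z) (fun y _ => ρ y) (fun y _ => 0) (2 * C1) M M
    ks ks0 ksv (by fun_prop) (by fun_prop) (fun y z => absb _ (hρb y)) (fun y z => by simpa)
    (fun y _ => by simpa using absb _ (hρb y))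
  have T1 := ker2 (fun y z => c₁ y z x) (fun y z => e1ρ x * ρ y * ρ z)
    (fun y z => e1ψ x * ψ y * ψ z) C1 (M * M) ((Φ₁ * δ * M + 2 * δ) * M)
    (hc₁int₁₂ x) (fun y z => hc₁nn _ _ _) (hc₁val₁₂ x) (by fun_prop) (by fun_prop)
    (fun y z => pb3 _ _ _ M ⟨(b1ρ x).1.le, (b1ρ x).2⟩ (hρb _) (hρb _))
    (fun y z => pb3 _ _ _ M ⟨(b1ψ x).1.le, (b1ψ x).2⟩ (hψb _) (hψb _))
    (fun y z => prod3 _ _ _ _ _ _ (Φ₁ * δ) M δ ⟨(b1ρ x).1.le, (b1ρ x).2⟩ (hρb _) (hψb _) (hψb _)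
      (E1 x) (hd _) (hd _))
  have T2 := ker2 (fun y z => c₁ x y z + c₁ y x z) (fun y z => (1 - e1ρ z) * ρ x * ρ y)
    (fun y z => (1 - e1ψ z) * ψ x * ψ y) (2 * C1) (M * M) ((Φ₁ * δ * M + 2 * δ) * M)
    ks ks0 ksv (by fun_prop) (by fun_prop)
    (fun y z => pb3 _ _ _ M ⟨by linarith [(b1ρ z).2], by linarith [(b1ρ z).1]⟩ (hρb _) (hρb _))
    (fun y z => pb3 _ _ _ M ⟨by linarith [(b1ψ z).2], by linarith [(b1ψ z).1]⟩ (hψb _) (hψb _))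
    (fun y z => prod3 _ _ _ _ _ _ (Φ₁ * δ) M δ
      ⟨by linarith [(b1ρ z).2], by linarith [(b1ρ z).1]⟩ (hρb _) (hψb _) (hψb _)
      (by rw [sub_sub_sub_cancel_left, abs_sub_comm]; exact E1 z) (hd _) (hd _))
  have T3 := ker1 (μ := volume) (fun y => c₂ y x) (fun y => e2ρ x * ρ y)
    (fun y => e2ψ x * ψ y) C2 M (Φ₂ * δ * M + δ)
    (hc₂int₁ x) (fun y => hc₂nn _ _) (hc₂val₁ x) (by fun_prop) (by fun_prop)
    (fun y => pb2 _ _ M ⟨(b2ρ x).1.le, (b2ρ x).2⟩ (hρb _))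
    (fun y => pb2 _ _ M ⟨(b2ψ x).1.le, (b2ψ x).2⟩ (hψb _))
    (fun y => prod2 _ _ _ _ (Φ₂ * δ) M δ ⟨(b2ρ x).1.le, (b2ρ x).2⟩ (hψb _)
      (E2 x) (hd _))
  have T4 := ker1 (μ := volume) (fun y => c₂ x y) (fun y => (1 - e2ρ y) * ρ x)
    (fun y => (1 - e2ψ y) * ψ x) C2 M (Φ₂ * δ * M + δ)
    (hc₂int₂ x) (fun y => hc₂nn _ _) (hc₂val₂ x) (by fun_prop) (by fun_prop)
    (fun y => pb2 _ _ M ⟨by linarith [(b2ρ y).2], by linarith [(b2ρ y).1]⟩ (hρb _))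
    (fun y => pb2 _ _ M ⟨by linarith [(b2ψ y).2], by linarith [(b2ψ y).1]⟩ (hψb _))
    (fun y => prod2 _ _ _ _ (Φ₂ * δ) M δ
      ⟨by linarith [(b2ρ y).2], by linarith [(b2ρ y).1]⟩ (hψb _)
      (by rw [sub_sub_sub_cancel_left, abs_sub_comm]; exact E2 y) (hd _))
  simp only [← mul_assoc] at T1 T2 T3 T4
  simp only [mul_zero, integral_zero, sub_zero] at H0
  generalize (∫ y, ∫ z, (c₁ x y z + c₁ y x z) * ρ y) = h1 at *
  generalize (∫ y, ∫ z, (c₁ x y z + c₁ y x z) * ψ y) = h2 at *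
  generalize (∫ y, ∫ z, c₁ y z x * e1ρ x * ρ y * ρ z) = t1 at *
  generalize (∫ y, ∫ z, c₁ y z x * e1ψ x * ψ y * ψ z) = t1' at *
  generalize (∫ y, ∫ z, (c₁ x y z + c₁ y x z) * (1 - e1ρ z) * ρ x * ρ y) = t2 at *
  generalize (∫ y, ∫ z, (c₁ x y z + c₁ y x z) * (1 - e1ψ z) * ψ x * ψ y) = t2' at *
  generalize (∫ y, c₂ y x * e2ρ x * ρ y) = t3 at *
  generalize (∫ y, c₂ y x * e2ψ x * ψ y) = t3' at *
  generalize (∫ y, c₂ x y * (1 - e2ρ y) * ρ x) = t4 at *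
  generalize (∫ y, c₂ x y * (1 - e2ψ y) * ψ x) = t4' at *
  have HH : |ρ x * (1/2 * h1 + C2) - ψ x * (1/2 * h2 + C2)| ≤ (2 * M * C1 + C2) * δ := by
    have e : ρ x * (1/2 * h1 + C2) - ψ x * (1/2 * h2 + C2)
      = (ρ x - ψ x) * (1/2 * h1 + C2) + ψ x * (1/2 * (h1 - h2)) := by ring
    rw [e]
    refine (abs_add_le _ _).trans ?_
    rw [abs_mul, abs_mul]
    have q1 : |1/2 * h1 + C2| ≤ C1 * M + C2 := by
      have := abs_le.1 H0
      rw [abs_le]; constructor <;> linarith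
    have q2 : |1/2 * (h1 - h2)| ≤ C1 * δ := by
      have := abs_le.1 H
      rw [abs_le]; constructor <;> linarith
    have p1 := mul_le_mul (hd x) q1 (abs_nonneg _) hδ
    have p2 := mul_le_mul (absb _ (hψb x)) q2 (abs_nonneg _) hM
    linarith
  have r := abs_le.1 HH
  have r1 := abs_le.1 T1
  have r2 := abs_le.1 T2
  have r3 := abs_le.1 T3
  have r4 := abs_le.1 T4
  rw [abs_le]
  constructor <;> nlinarith

lemma kderiv_meas {d : ℕ}
    (c₁ : Rd d → Rd d → Rd d → ℝ)
    (hc₁meas : Measurable fun p : Rd d × Rd d × Rd d => c₁ p.1 p.2.1 p.2.2)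
    (c₂ : Rd d → Rd d → ℝ) (C2 : ℝ)
    (hc₂meas : Measurable fun p : Rd d × Rd d => c₂ p.1 p.2)
    (φ₁ : Rd d → ℝ) (hφ₁meas : Measurable φ₁)
    (φ₂ : Rd d → ℝ) (hφ₂meas : Measurable φ₂)
    (ρ : Rd d → ℝ) (hρ : Measurable ρ) : Measurable (kderiv c₁ c₂ φ₁ φ₂ C2 ρ) := by
  have m1 := exp_meas φ₁ hφ₁meas ρ hρ
  have m2 := exp_meas φ₂ hφ₂meas ρ hρ
  have cm : ∀ {α : Type} [MeasurableSpace α] (f g h : α → Rd d), Measurable f → Measurable g →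
      Measurable h → Measurable fun a => c₁ (f a) (g a) (h a) := fun f g h hf hg hh =>
    hc₁meas.comp (hf.prodMk (hg.prodMk hh))
  have cm2 : ∀ {α : Type} [MeasurableSpace α] (f g : α → Rd d), Measurable f → Measurable g →
      Measurable fun a => c₂ (f a) (g a) := fun f g hf hg => hc₂meas.comp (hf.prodMk hg)
  unfold kderiv hker R2
  generalize hg1 : (fun x => Real.exp (-∫ u, φ₁ (x - u) * ρ u)) = e1 at *
  generalize hg2 : (fun x => Real.exp (-∫ u, φ₂ (x - u) * ρ u)) = e2 at *
  simp only [fun x => congrFun hg1 x, fun x => congrFun hg2 x]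
  have A : Measurable fun x => ∫ y, ∫ z, (c₁ x y z + c₁ y x z) * ρ y := by
    refine meas_int _ (meas_int (fun (p : Rd d × Rd d) z =>
      (c₁ p.1 p.2 z + c₁ p.2 p.1 z) * ρ p.2) ?_)
    have := cm (fun q : (Rd d × Rd d) × Rd d => q.1.1) (fun q => q.1.2) (fun q => q.2)
      (by fun_prop) (by fun_prop) (by fun_prop)
    have := cm (fun q : (Rd d × Rd d) × Rd d => q.1.2) (fun q => q.1.1) (fun q => q.2)
      (by fun_prop) (by fun_prop) (by fun_prop)
    fun_prop
  have B : Measurable fun x => ∫ y, ∫ z, c₁ y z x * e1 x * ρ y * ρ z := by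
    refine meas_int _ (meas_int (fun (p : Rd d × Rd d) z =>
      c₁ p.2 z p.1 * e1 p.1 * ρ p.2 * ρ z) ?_)
    have := cm (fun q : (Rd d × Rd d) × Rd d => q.1.2) (fun q => q.2) (fun q => q.1.1)
      (by fun_prop) (by fun_prop) (by fun_prop)
    fun_prop
  have C : Measurable fun x => ∫ y, ∫ z, (c₁ x y z + c₁ y x z) * (1 - e1 z) * ρ x * ρ y := by
    refine meas_int _ (meas_int (fun (p : Rd d × Rd d) z =>
      (c₁ p.1 p.2 z + c₁ p.2 p.1 z) * (1 - e1 z) * ρ p.1 * ρ p.2) ?_)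
    have := cm (fun q : (Rd d × Rd d) × Rd d => q.1.1) (fun q => q.1.2) (fun q => q.2)
      (by fun_prop) (by fun_prop) (by fun_prop)
    have := cm (fun q : (Rd d × Rd d) × Rd d => q.1.2) (fun q => q.1.1) (fun q => q.2)
      (by fun_prop) (by fun_prop) (by fun_prop)
    fun_prop
  have D : Measurable fun x => ∫ y, c₂ y x * e2 x * ρ y := by
    refine meas_int _ ?_
    have := cm2 (fun q : Rd d × Rd d => q.2) (fun q => q.1) (by fun_prop) (by fun_prop)
    fun_prop
  have E : Measurable fun x => ∫ y, c₂ x y * (1 - e2 y) * ρ x := by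
    refine meas_int _ ?_
    fun_prop
  fun_prop

lemma kderiv_quasi {d : ℕ}
    (c₁ : Rd d → Rd d → Rd d → ℝ) (hc₁nn : ∀ x y z, 0 ≤ c₁ x y z)
    (c₂ : Rd d → Rd d → ℝ) (C2 : ℝ) (hc₂nn : ∀ x y, 0 ≤ c₂ x y)
    (φ₁ : Rd d → ℝ) (hφ₁nn : ∀ u, 0 ≤ φ₁ u)
    (φ₂ : Rd d → ℝ) (hφ₂nn : ∀ u, 0 ≤ φ₂ u)
    (ρ : Rd d → ℝ) (hρ : ∀ x, 0 ≤ ρ x) (x : Rd d) (hx : ρ x = 0) :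
    0 ≤ kderiv c₁ c₂ φ₁ φ₂ C2 ρ x := by
  have b1 := exp_mem φ₁ hφ₁nn ρ hρ
  have b2 := exp_mem φ₂ hφ₂nn ρ hρ
  unfold kderiv R2
  simp only [hx, neg_zero, zero_mul, mul_zero, integral_zero, zero_add, add_zero]
  have h1 : 0 ≤ ∫ y, ∫ z, c₁ y z x * Real.exp (-∫ u, φ₁ (x - u) * ρ u) * ρ y * ρ z :=
    integral_nonneg fun y => integral_nonneg fun z => mul_nonneg (mul_nonneg
      (mul_nonneg (hc₁nn _ _ _) (Real.exp_pos _).le) (hρ _)) (hρ _)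
  have h2 : 0 ≤ ∫ y, c₂ y x * Real.exp (-∫ u, φ₂ (x - u) * ρ u) * ρ y :=
    integral_nonneg fun y => mul_nonneg (mul_nonneg (hc₂nn _ _) (Real.exp_pos _).le) (hρ _)
  linarith

lemma kderiv_zero {d : ℕ}
    (c₁ : Rd d → Rd d → Rd d → ℝ) (c₂ : Rd d → Rd d → ℝ) (C2 : ℝ)
    (φ₁ φ₂ : Rd d → ℝ) (x : Rd d) :
    kderiv c₁ c₂ φ₁ φ₂ C2 (fun _ => 0) x = 0 := by
  simp [kderiv, R2]

/-- Bounded measurable functions with the sup norm. -/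
def BE (d : ℕ) : Submodule ℝ (lp (fun _ : Rd d => ℝ) ⊤) where
  carrier := {f | Measurable (f : Rd d → ℝ)}
  add_mem' := fun {f g} hf hg => by
    have : Measurable ((f : Rd d → ℝ) + (g : Rd d → ℝ)) := Measurable.add hf hg
    exact this
  zero_mem' := by
    have : Measurable (fun _ : Rd d => (0:ℝ)) := measurable_const
    exact this
  smul_mem' := fun c f hf => by
    have : Measurable (c • (f : Rd d → ℝ)) := Measurable.const_smul hf c
    simpa using this

/-- underlying function -/
def toF {d : ℕ} (f : BE d) : Rd d → ℝ := (f : lp (fun _ : Rd d => ℝ) ⊤)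

lemma toF_meas {d : ℕ} (f : BE d) : Measurable (toF f) := f.2

lemma toF_le {d : ℕ} (f : BE d) (x : Rd d) : |toF f x| ≤ ‖f‖ :=
  lp.norm_apply_le_norm (by simp) (f : lp (fun _ : Rd d => ℝ) ⊤) x

lemma norm_le_BE {d : ℕ} (f : BE d) (C : ℝ) (h : ∀ x, |toF f x| ≤ C) : ‖f‖ ≤ C :=
  lp.norm_le_of_forall_le' (f := (f : lp (fun _ : Rd d => ℝ) ⊤)) C h

lemma linf_toF {d : ℕ} (f : BE d) : linf (toF f) = ‖f‖ := rfl

lemma toF_sub {d : ℕ} (f g : BE d) (x : Rd d) : toF (f - g) x = toF f x - toF g x := rfl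

lemma toF_smul {d : ℕ} (c : ℝ) (f : BE d) (x : Rd d) : toF (c • f) x = c * toF f x := rfl

lemma toF_add {d : ℕ} (f g : BE d) (x : Rd d) : toF (f + g) x = toF f x + toF g x := rfl

lemma toF_inj {d : ℕ} (f g : BE d) (h : toF f = toF g) : f = g :=
  Subtype.ext (Subtype.ext h)

/-- constructor -/
def mkB {d : ℕ} (f : Rd d → ℝ) (h : MemLinf f) : BE d :=
  ⟨⟨f, memℓp_infty (by
    obtain ⟨M, hM⟩ := h.2
    exact ⟨M, by rintro _ ⟨x, rfl⟩; exact hM x⟩)⟩, h.1⟩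

lemma toF_mkB {d : ℕ} (f : Rd d → ℝ) (h : MemLinf f) : toF (mkB f h) = f := rfl

lemma BE_closed (d : ℕ) : IsClosed (BE d : Set (lp (fun _ : Rd d => ℝ) ⊤)) := by
  refine IsSeqClosed.isClosed ?_
  intro u f hu hf
  refine measurable_of_tendsto_metrizable (f := fun n => ((u n : lp (fun _ : Rd d => ℝ) ⊤) : Rd d → ℝ))
    (fun n => hu n) ?_
  rw [tendsto_pi_nhds]
  intro x
  rw [tendsto_iff_norm_sub_tendsto_zero] at hf ⊢
  exact squeeze_zero (fun n => norm_nonneg _)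
    (fun n => lp.norm_apply_le_norm (by simp) (u n - f) x) hf

instance (d : ℕ) : CompleteSpace (BE d) := (BE_closed d).completeSpace_coe

/-- evaluation -/
def evB {d : ℕ} (x : Rd d) : BE d →L[ℝ] ℝ :=
  LinearMap.mkContinuous
    { toFun := fun f => toF f x
      map_add' := fun f g => rfl
      map_smul' := fun c f => rfl } 1 (fun f => by
        rw [one_mul]; exact toF_le f x)

lemma deriv_iff {d : ℕ} (ρ : ℝ → Rd d → ℝ) (α : ℝ → BE d) (g : BE d) (S : Set ℝ)
    (h : ∀ s ∈ S, toF (α s) = ρ s) (t : ℝ) (ht : t ∈ S) :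
    HasLinfDerivWithinAt ρ (toF g) S t ↔ HasDerivWithinAt α g S t := by
  rw [hasDerivWithinAt_iff_isLittleO, Asymptotics.isLittleO_iff]
  unfold HasLinfDerivWithinAt
  refine forall_congr' fun ε => imp_congr_right fun hε => ?_
  rw [eventually_nhdsWithin_iff, Metric.eventually_nhds_iff]
  refine exists_congr fun δ => and_congr_right fun hδ => ?_
  have key : ∀ s ∈ S, linf (fun x => ρ s x - ρ t x - (s - t) * toF g x)
      = ‖α s - α t - (s - t) • g‖ := by
    intro s hs
    rw [← linf_toF, ← h s hs, ← h t ht]; rfl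
  constructor
  · intro H s hs1 hs2
    have := H s hs2 hs1
    rwa [key s hs2] at this
  · intro H s hs2 hs1
    rw [key s hs2]
    exact H hs1 hs2

theorem abs_main {d : ℕ} (G : (Rd d → ℝ) → Rd d → ℝ)
    (hmeas : ∀ ρ, Measurable ρ → Measurable (G ρ))
    (hlip : ∀ M : ℝ, 0 ≤ M → ∃ L : ℝ, 0 ≤ L ∧ ∀ (ρ ψ : Rd d → ℝ) (δ : ℝ), Measurable ρ →
      Measurable ψ → (∀ x, 0 ≤ ρ x ∧ ρ x ≤ M) → (∀ x, 0 ≤ ψ x ∧ ψ x ≤ M) →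
      (∀ x, |ρ x - ψ x| ≤ δ) → ∀ x, |G ρ x - G ψ x| ≤ L * δ)
    (hzero : ∀ x, G (fun _ => 0) x = 0)
    (hquasi : ∀ ρ : Rd d → ℝ, (∀ x, 0 ≤ ρ x) → ∀ x, ρ x = 0 → 0 ≤ G ρ x)
    (ρ₀ : Rd d → ℝ) (hρ₀mem : MemLinf ρ₀) (hρ₀nn : ∀ x, 0 ≤ ρ₀ x) (P : ℝ → (ℝ → Rd d → ℝ) → Prop)
    (hP : ∀ T ρ, P T ρ ↔ (∀ t ∈ Icc (0:ℝ) T, MemLinf (ρ t)) ∧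
      (∀ t ∈ Icc (0:ℝ) T, ∀ x, 0 ≤ ρ t x) ∧ ρ 0 = ρ₀ ∧
      (∀ t ∈ Icc (0:ℝ) T, HasLinfDerivWithinAt ρ (G (ρ t)) (Icc 0 T) t) ∧
      LinfContOn (Icc 0 T) (fun t => G (ρ t))) :
    ∃ T : ℝ, 0 < T ∧ (∃ ρ, P T ρ) ∧
      (∀ ρ ψ, P T ρ → P T ψ → ∀ t ∈ Icc (0:ℝ) T, ρ t = ψ t) := by
  classical
  -- positive part
  have pm : ∀ f : BE d, Measurable fun x => max (toF f x) 0 := fun f =>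
    (toF_meas f).max measurable_const
  have pb : ∀ (f : BE d) (R : ℝ), ‖f‖ ≤ R → ∀ x, 0 ≤ max (toF f x) 0 ∧ max (toF f x) 0 ≤ R :=
    fun f R hR x => ⟨le_max_right _ _, max_le ((le_abs_self _).trans ((toF_le f x).trans hR))
      ((norm_nonneg f).trans hR)⟩
  have GM : ∀ f : BE d, MemLinf (G fun x => max (toF f x) 0) := by
    intro f
    refine ⟨hmeas _ (pm f), ?_⟩
    obtain ⟨L, hL, H⟩ := hlip ‖f‖ (norm_nonneg f)
    refine ⟨L * ‖f‖, fun x => ?_⟩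
    have := H _ (fun _ => 0) ‖f‖ (pm f) measurable_const (pb f _ le_rfl)
      (fun _ => ⟨le_rfl, norm_nonneg f⟩) (fun x => by
        rw [sub_zero, abs_of_nonneg (pb f _ le_rfl x).1]; exact (pb f _ le_rfl x).2) x
    rwa [hzero, sub_zero] at this
  let V : BE d → BE d := fun f => mkB _ (GM f)
  have V0 : V 0 = 0 := by
    apply toF_inj
    funext x
    change G (fun x => max (0:ℝ) 0) x = 0
    simpa using hzero x
  have VL : ∀ R : ℝ, 0 ≤ R → ∃ K : NNReal, LipschitzOnWith K V (Metric.closedBall 0 R) := by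
    intro R hR
    obtain ⟨L, hL, H⟩ := hlip R hR
    refine ⟨⟨L, hL⟩, LipschitzOnWith.of_dist_le_mul fun f hf g hg => ?_⟩
    rw [mem_closedBall_zero_iff] at hf hg
    rw [dist_eq_norm, dist_eq_norm]
    refine norm_le_BE _ _ fun x => ?_
    refine H _ _ _ (pm f) (pm g) (pb f R hf) (pb g R hg) (fun x => ?_) x
    refine (abs_max_sub_max_le_abs _ _ _).trans ?_
    rw [← toF_sub]
    exact toF_le _ x
  have Vpos : ∀ (f : BE d) (ρ : Rd d → ℝ), toF f = ρ → (∀ x, 0 ≤ ρ x) → toF (V f) = G ρ := by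
    intro f ρ h h0
    have : (fun x => max (toF f x) 0) = ρ := by
      funext x; rw [h]; exact max_eq_left (h0 x)
    change G (fun x => max (toF f x) 0) = G ρ
    rw [this]
  -- Picard-Lindelöf
  let x₀ : BE d := mkB ρ₀ hρ₀mem
  obtain ⟨K, hK⟩ := VL (‖x₀‖ + 1) (by positivity)
  have hsub : Metric.closedBall x₀ ((1 : NNReal) : ℝ) ⊆ Metric.closedBall 0 (‖x₀‖ + 1) := by
    intro f hf
    rw [mem_closedBall_zero_iff]
    rw [mem_closedBall_iff_norm] at hf
    have := norm_add_le x₀ (f - x₀)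
    rw [add_sub_cancel] at this
    simp only [NNReal.coe_one] at hf
    linarith
  let B : NNReal := K * (‖x₀‖₊ + 1)
  have hB : ∀ f ∈ Metric.closedBall x₀ ((1 : NNReal) : ℝ), ‖V f‖ ≤ B := by
    intro f hf
    have h1 := hK.dist_le_mul f (hsub hf) 0 (by simp; positivity)
    rw [V0, dist_zero_right, dist_zero_right] at h1
    have h2 := hsub hf
    rw [mem_closedBall_zero_iff] at h2
    exact h1.trans (mul_le_mul_of_nonneg_left h2 K.2)
  have hB0 : 0 ≤ (B : ℝ) := B.2
  let T : ℝ := 1 / (B + 1)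
  have hT : 0 < T := by positivity
  have hPL : IsPicardLindelof (fun _ => V) (⟨0, le_rfl, hT.le⟩ : Icc (0:ℝ) T) x₀ 1 0 B K := by
    refine IsPicardLindelof.of_time_independent hB (hK.mono hsub) ?_
    simp only [sub_zero, sub_self, max_eq_left hT.le, NNReal.coe_one, NNReal.coe_zero]
    change (B : ℝ) * (1 / (B + 1)) ≤ 1
    rw [mul_one_div, div_le_one (by positivity)]
    linarith
  -- continuity and bounds along curves
  have curve : ∀ α : ℝ → BE d, (∀ t ∈ Icc (0:ℝ) T, HasDerivWithinAt α (V (α t)) (Icc 0 T) t) →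
      ContinuousOn α (Icc 0 T) ∧ ∃ R : ℝ, ∀ t ∈ Icc (0:ℝ) T, ‖α t‖ ≤ R := by
    intro α hα
    have hc : ContinuousOn α (Icc 0 T) := fun t ht => (hα t ht).continuousWithinAt
    exact ⟨hc, isCompact_Icc.exists_bound_of_continuousOn hc⟩
  have right : ∀ {F : Type} [NormedAddCommGroup F] [NormedSpace ℝ F] (α : ℝ → F) (α' : ℝ → F),
      (∀ t ∈ Icc (0:ℝ) T, HasDerivWithinAt α (α' t) (Icc 0 T) t) →
      ∀ t ∈ Ico (0:ℝ) T, HasDerivWithinAt α (α' t) (Ici t) t := by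
    intro F _ _ α α' hα t ht
    exact (hα t ⟨ht.1, ht.2.le⟩).mono_of_mem_nhdsWithin (Icc_mem_nhdsGE_of_mem ht)
  refine ⟨T, hT, ?_, ?_⟩
  · obtain ⟨α, hα0, hα⟩ := hPL.exists_eq_forall_mem_Icc_hasDerivWithinAt₀
    simp only at hα0
    obtain ⟨hc, R, hR⟩ := curve α hα
    have nn : ∀ t ∈ Icc (0:ℝ) T, ∀ x, 0 ≤ toF (α t) x := by
      intro t ht x
      have hu : ∀ t ∈ Icc (0:ℝ) T, HasDerivWithinAt (fun t => -toF (α t) x)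
          (-toF (V (α t)) x) (Icc 0 T) t := fun t ht =>
        ((evB x).hasFDerivAt.comp_hasDerivWithinAt t (hα t ht)).neg
      have main : ∀ ε > 0, -toF (α t) x ≤ ε * (1 + t) := by
        intro ε hε
        refine image_le_of_deriv_right_lt_deriv_boundary' (f := fun t => -toF (α t) x)
          (f' := fun t => -toF (V (α t)) x) (a := 0) (b := T) (B := fun t => ε * (1 + t))
          (B' := fun _ => ε) (fun t ht => (hu t ht).continuousWithinAt) (right _ _ hu) ?_
          (by fun_prop) ?_ ?_ ht
        · simp only [hα0]
          have := hρ₀nn x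
          change -ρ₀ x ≤ _
          nlinarith
        · intro s hs
          have := ((hasDerivAt_id s).const_add 1).const_mul ε
          simpa using this.hasDerivWithinAt
        · intro s hs heq
          have hneg : toF (α s) x ≤ 0 := by nlinarith [hs.1]
          have := hquasi (fun y => max (toF (α s) y) 0) (fun y => le_max_right _ _) x
            (max_eq_right hneg)
          change -(G (fun y => max (toF (α s) y) 0) x) < ε
          linarith
      have h2 : -toF (α t) x ≤ 0 := by
        refine le_of_forall_pos_le_add fun ε hε => ?_
        have h1t : 0 < 1 + t := by linarith [ht.1]
        have := main (ε / (1 + t)) (by positivity)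
        rw [div_mul_cancel₀ _ h1t.ne'] at this
        linarith
      linarith
    refine ⟨fun t => toF (α t), (hP _ _).2 ⟨?_, nn, ?_, ?_, ?_⟩⟩
    · exact fun t _ => ⟨toF_meas _, ‖α t‖, toF_le _⟩
    · simp only [hα0]; rfl
    · intro t ht
      rw [← Vpos (α t) _ rfl (nn t ht)]
      exact (deriv_iff _ α _ _ (fun _ _ => rfl) t ht).2 (hα t ht)
    · have hR0 : 0 ≤ R := (norm_nonneg _).trans (hR 0 ⟨le_rfl, hT.le⟩)
      obtain ⟨K', hK'⟩ := VL R hR0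
      have hcV : ContinuousOn (fun t => V (α t)) (Icc 0 T) :=
        hK'.continuousOn.comp hc fun t ht => mem_closedBall_zero_iff.2 (hR t ht)
      rw [Metric.continuousOn_iff] at hcV
      intro t ht ε hε
      obtain ⟨δ, hδ, H⟩ := hcV t ht ε hε
      refine ⟨δ, hδ, fun s hs hst => ?_⟩
      have := H s hs hst
      rw [dist_eq_norm, ← linf_toF] at this
      simp only
      rw [← Vpos (α t) _ rfl (nn t ht), ← Vpos (α s) _ rfl (nn s hs)]
      exact this
  · intro ρ ψ hρ hψ
    have lift : ∀ ρ, P T ρ → ∃ α : ℝ → BE d, α 0 = x₀ ∧ (∀ t ∈ Icc (0:ℝ) T, toF (α t) = ρ t) ∧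
        ∀ t ∈ Icc (0:ℝ) T, HasDerivWithinAt α (V (α t)) (Icc 0 T) t := by
      intro ρ h
      obtain ⟨h1, h2, h3, h4, -⟩ := (hP _ _).1 h
      have hF : ∀ t ∈ Icc (0:ℝ) T,
          toF (if h : MemLinf (ρ t) then mkB (ρ t) h else 0) = ρ t := by
        intro t ht
        rw [dif_pos (h1 t ht)]; rfl
      refine ⟨fun t => if h : MemLinf (ρ t) then mkB (ρ t) h else 0, ?_, hF, ?_⟩
      · apply toF_inj
        rw [hF 0 ⟨le_rfl, hT.le⟩, h3]; rfl
      · intro t ht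
        refine (deriv_iff ρ _ _ _ hF t ht).1 ?_
        rw [Vpos _ _ (hF t ht) (h2 t ht)]
        exact h4 t ht
    obtain ⟨α, hα0, hα1, hα⟩ := lift ρ hρ
    obtain ⟨β, hβ0, hβ1, hβ⟩ := lift ψ hψ
    obtain ⟨hc, R, hR⟩ := curve α hα
    obtain ⟨hc', R', hR'⟩ := curve β hβ
    have hR0 : 0 ≤ R := (norm_nonneg _).trans (hR 0 ⟨le_rfl, hT.le⟩)
    obtain ⟨K', hK'⟩ := VL (max R R') (hR0.trans (le_max_left _ _))
    have := ODE_solution_unique_of_mem_Icc_right (v := fun _ => V)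
      (s := fun _ => Metric.closedBall 0 (max R R')) (K := K') (fun _ _ => hK')
      hc (right _ _ hα) (fun t ht => mem_closedBall_zero_iff.2
        ((hR t ⟨ht.1, ht.2.le⟩).trans (le_max_left _ _)))
      hc' (right _ _ hβ) (fun t ht => mem_closedBall_zero_iff.2
        ((hR' t ⟨ht.1, ht.2.le⟩).trans (le_max_right _ _))) (hα0.trans hβ0.symm)
    intro t ht
    rw [← hα1 t ht, ← hβ1 t ht, this ht]

theorem statement0 {d : ℕ} (hd : 1 ≤ d)
    (c₁ : Rd d → Rd d → Rd d → ℝ) (C1 : ℝ)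
    (hc₁meas : Measurable fun p : Rd d × Rd d × Rd d => c₁ p.1 p.2.1 p.2.2)
    (hc₁nn : ∀ x y z, 0 ≤ c₁ x y z)
    (hc₁sym : ∀ x y z, c₁ x y z = c₁ y x z)
    (hc₁int₁₂ : ∀ z, Integrable fun p : Rd d × Rd d => c₁ p.1 p.2 z)
    (hc₁int₁₃ : ∀ y, Integrable fun p : Rd d × Rd d => c₁ p.1 y p.2)
    (hc₁int₂₃ : ∀ x, Integrable fun p : Rd d × Rd d => c₁ x p.1 p.2)
    (hc₁val₁₂ : ∀ z, (∫ x, ∫ y, c₁ x y z) = C1)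
    (hc₁val₁₃ : ∀ y, (∫ x, ∫ z, c₁ x y z) = C1)
    (hc₁val₂₃ : ∀ x, (∫ y, ∫ z, c₁ x y z) = C1)
    (c₂ : Rd d → Rd d → ℝ) (C2 : ℝ)
    (hc₂meas : Measurable fun p : Rd d × Rd d => c₂ p.1 p.2)
    (hc₂nn : ∀ x y, 0 ≤ c₂ x y)
    (hc₂int₁ : ∀ y, Integrable fun x => c₂ x y)
    (hc₂int₂ : ∀ x, Integrable fun y => c₂ x y)
    (hc₂val₁ : ∀ y, (∫ x, c₂ x y) = C2)
    (hc₂val₂ : ∀ x, (∫ y, c₂ x y) = C2)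
    (φ₁ : Rd d → ℝ) (Φ₁ : ℝ) (hφ₁meas : Measurable φ₁) (hφ₁nn : ∀ u, 0 ≤ φ₁ u)
    (hφ₁int : Integrable φ₁) (hφ₁val : (∫ u, φ₁ u) = Φ₁)
    (φ₂ : Rd d → ℝ) (Φ₂ : ℝ) (hφ₂meas : Measurable φ₂) (hφ₂nn : ∀ u, 0 ≤ φ₂ u)
    (hφ₂int : Integrable φ₂) (hφ₂val : (∫ u, φ₂ u) = Φ₂)
    (ρ₀ : Rd d → ℝ) (hρ₀mem : MemLinf ρ₀) (hρ₀nn : ∀ x, 0 ≤ ρ₀ x)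
    :
    ∃ T : ℝ, 0 < T ∧
      (∃ ρ : ℝ → Rd d → ℝ, IsSol c₁ c₂ φ₁ φ₂ C2 ρ₀ T ρ) ∧
      (∀ ρ ψ : ℝ → Rd d → ℝ, IsSol c₁ c₂ φ₁ φ₂ C2 ρ₀ T ρ → IsSol c₁ c₂ φ₁ φ₂ C2 ρ₀ T ψ →
        ∀ t ∈ Icc (0:ℝ) T, ρ t = ψ t) := by
  exact abs_main (kderiv c₁ c₂ φ₁ φ₂ C2)
    (fun ρ hρ => kderiv_meas c₁ hc₁meas c₂ C2 hc₂meas φ₁ hφ₁meas φ₂ hφ₂meas ρ hρ)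
    (fun M hM => kderiv_lip c₁ C1 hc₁nn hc₁sym hc₁int₁₂ hc₁int₂₃ hc₁val₁₂ hc₁val₂₃ c₂ C2 hc₂nn
      hc₂int₁ hc₂int₂ hc₂val₁ hc₂val₂ φ₁ Φ₁ hφ₁meas hφ₁nn hφ₁int hφ₁val φ₂ Φ₂ hφ₂meas hφ₂nn
      hφ₂int hφ₂val M hM)
    (fun x => kderiv_zero c₁ c₂ C2 φ₁ φ₂ x)
    (fun ρ hρ x hx => kderiv_quasi c₁ hc₁nn c₂ C2 hc₂nn φ₁ hφ₁nn φ₂ hφ₂nn ρ hρ x hx)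
    ρ₀ hρ₀mem hρ₀nn (IsSol c₁ c₂ φ₁ φ₂ C2 ρ₀) (fun T ρ => Iff.rfl)
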